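/- Let ε > 0 and let T' be a 3-linear form on ℝ^n × ℝ^n × ℝ^n whose coefficient tensor satisfies T'_{abc} = 0 whenever at least two of the indices a, b, c are equal. Suppose that the three polynomials ε·(‖x‖² + ‖y‖²‖z‖²) − T'(x,y,z), ε·(‖y‖² + ‖x‖²‖z‖²) − T'(x,y,z), and ε·(‖z‖² + ‖x‖²‖y‖²) − T'(x,y,z) are each sums of squares of polynomials. Then the inequality T'(x,y,z) ≤ (3ε/2)·Σ_{i=1}^n Σ_{j≠i} y_i²·(x_j² + z_j² + (1/2)y_j²·(‖x‖² + ‖z‖²)) has a degree-6 sum-of-squares proof from the constraint ‖y‖² = 1; that is, there exists a polynomial q of degree at most 4 such that the right-hand side minus T'(x,y,z) plus q·(1 − ‖y‖²) is a sum of squares. -/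

import Mathlib

open scoped BigOperators
open MvPolynomial

noncomputable section

abbrev XVar {n : ℕ} (i : Fin n) : MvPolynomial (Fin n ⊕ Fin n ⊕ Fin n) ℝ :=
  X (Sum.inl i)
abbrev YVar {n : ℕ} (i : Fin n) : MvPolynomial (Fin n ⊕ Fin n ⊕ Fin n) ℝ :=
  X (Sum.inr (Sum.inl i))
abbrev ZVar {n : ℕ} (i : Fin n) : MvPolynomial (Fin n ⊕ Fin n ⊕ Fin n) ℝ :=
  X (Sum.inr (Sum.inr i))

/-- The polynomial `T'(x,y,z) = Σ_{a,b,c} T'_{abc} x_a y_b z_c` of a trilinear form. -/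
def formPoly {n : ℕ} (T' : Fin n → Fin n → Fin n → ℝ) :
    MvPolynomial (Fin n ⊕ Fin n ⊕ Fin n) ℝ :=
  ∑ a, ∑ b, ∑ c, C (T' a b c) * XVar a * YVar b * ZVar c

section Aux
variable {R : Type*} [CommRing R] {n : ℕ}

theorem ss_sq (a : R) : IsSumSq (a ^ 2) := by
  rw [pow_two]; exact IsSumSq.mul_self a

theorem ss_congr {s t : R} (h : IsSumSq s) (e : t = s) : IsSumSq t := e ▸ h

theorem ss_nsm (k : ℕ) {s : R} (h : IsSumSq s) : IsSumSq ((k : R) * s) :=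
  (IsSumSq.natCast k).mul h

theorem ss_map {S : Type*} [CommRing S] (f : R →+* S) {s : R} (h : IsSumSq s) :
    IsSumSq (f s) := by
  induction h with
  | zero => rw [map_zero]; exact IsSumSq.zero
  | sq_add a _ ih => rw [map_add, map_mul]; exact (IsSumSq.mul_self _).add ih

/-- `‖v‖² - v_a²` is a sum of squares. -/
theorem ss_sub1 (v : Fin n → R) (a : Fin n) : IsSumSq ((∑ i, v i ^ 2) - v a ^ 2) := by
  rw [← Finset.sum_erase_eq_sub (Finset.mem_univ a)]
  exact IsSumSq.sum fun i _ => ss_sq _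

theorem ss_sub2 (v : Fin n → R) {a j : Fin n} (h : j ≠ a) :
    IsSumSq ((∑ i, v i ^ 2) - v a ^ 2 - v j ^ 2) := by
  rw [← Finset.sum_erase_eq_sub (Finset.mem_univ a),
    ← Finset.sum_erase_eq_sub (Finset.mem_erase.2 ⟨h, Finset.mem_univ j⟩)]
  exact IsSumSq.sum fun i _ => ss_sq _

/-- From `Σ_j w_j² ≤ S` and `w_a = 0` : `Σ_j v_j² w_j² ≤ (‖v‖² - v_a²) S`. -/
theorem ss_weight (v w : Fin n → R) (S : R) (a : Fin n) (hw : w a = 0)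
    (h : IsSumSq (S - ∑ j, w j ^ 2)) :
    IsSumSq (((∑ i, v i ^ 2) - v a ^ 2) * S - ∑ j, v j ^ 2 * w j ^ 2) := by
  have h2 : IsSumSq (∑ j, w j ^ 2 * ((∑ i, v i ^ 2) - v a ^ 2 - v j ^ 2)) := by
    refine IsSumSq.sum fun j _ => ?_
    by_cases hj : j = a
    · subst hj; rw [hw]; simp
    · exact (ss_sq _).mul (ss_sub2 v hj)
  have h1 := ((ss_sub1 v a).mul h).add h2
  refine ss_congr h1 ?_
  simp only [mul_sub, Finset.sum_sub_distrib, ← Finset.sum_mul]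
  have : ∑ j, w j ^ 2 * v j ^ 2 = ∑ j, v j ^ 2 * w j ^ 2 :=
    Finset.sum_congr rfl fun j _ => mul_comm _ _
  rw [this]
  ring

theorem core_lemma (y z m : Fin n → R) (N T : Fin n → Fin n → R)
    (hN : ∀ a, N a a = 0) (hT : ∀ a, T a a = 0)
    (hm : ∀ a, ∑ i, y i * T a i = m a)
    (b1 : ∀ i, IsSumSq ((∑ k, y k ^ 2) * ((∑ k, z k ^ 2) - z i ^ 2)
      - ∑ a, (m a - z i * N a i) ^ 2))
    (b2 : ∀ i, IsSumSq (((∑ k, y k ^ 2) - y i ^ 2) - ∑ a, N a i ^ 2))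
    (b3 : ∀ a, IsSumSq (((∑ k, z k ^ 2) - z a ^ 2) - ∑ i, T a i ^ 2))
    (b4 : ∀ a, IsSumSq (((∑ k, y k ^ 2) - y a ^ 2) - ∑ i, N a i ^ 2)) :
    IsSumSq (56 * (∑ k, y k ^ 2) * (∑ i, y i ^ 2 * ((∑ k, z k ^ 2) - z i ^ 2))
      + 96 * (∑ i, y i ^ 2 * (((∑ k, y k ^ 2) - y i ^ 2) * z i ^ 2))
      - ((∑ i, ∑ a, (5 * y i * m a + y i * z i * N a i + 4 * y a ^ 2 * T a i) ^ 2)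
        - ∑ a, 25 * y a ^ 2 * m a ^ 2)) := by
  set r := ∑ k, y k ^ 2 with hr
  set Z := ∑ k, z k ^ 2 with hZ
  have e1 : IsSumSq (∑ i, y i ^ 2 * (r * (Z - z i ^ 2) - ∑ a, (m a - z i * N a i) ^ 2)) :=
    IsSumSq.sum fun i _ => (ss_sq _).mul (b1 i)
  have e2 : IsSumSq (∑ i, y i ^ 2 * z i ^ 2 * ((r - y i ^ 2) - ∑ a, N a i ^ 2)) :=
    IsSumSq.sum fun i _ => ((ss_sq _).mul (ss_sq _)).mul (b2 i)
  have e3 : IsSumSq (∑ i, ∑ a ∈ Finset.univ.erase i, y i ^ 2 * (m a - 3 * (z i * N a i)) ^ 2) :=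
    IsSumSq.sum fun i _ => IsSumSq.sum fun a _ => (ss_sq _).mul (ss_sq _)
  have e4 : IsSumSq (∑ i, ∑ a, (y a * z i * N a i - y a * y i * T a i) ^ 2) :=
    IsSumSq.sum fun i _ => IsSumSq.sum fun a _ => ss_sq _
  have e5 : IsSumSq (∑ a, y a ^ 2 * ((Z - z a ^ 2) * (r - y a ^ 2)
      - ∑ i, z i ^ 2 * N a i ^ 2)) :=
    IsSumSq.sum fun a _ => (ss_sq _).mul (ss_weight z (N a) _ a (hN a) (b4 a))
  have e6 : IsSumSq (∑ a, y a ^ 2 * ((r - y a ^ 2) * (Z - z a ^ 2)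
      - ∑ i, y i ^ 2 * T a i ^ 2)) :=
    IsSumSq.sum fun a _ => (ss_sq _).mul (ss_weight y (T a) _ a (hT a) (b3 a))
  have e7 : IsSumSq (∑ a, y a ^ 2 * ((r - y a ^ 2) * (Z - z a ^ 2))) :=
    IsSumSq.sum fun a _ => (ss_sq _).mul ((ss_sub1 y a).mul (ss_sub1 z a))
  have e8 : IsSumSq (∑ a, (y a ^ 2) ^ 2 * ((Z - z a ^ 2) - ∑ i, T a i ^ 2)) :=
    IsSumSq.sum fun a _ => (ss_sq _).mul (b3 a)
  have tot := (((((((ss_nsm 40 e1).add (ss_nsm 96 e2)).add (ss_nsm 15 e3)).add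
    (ss_nsm 4 e4)).add (ss_nsm 4 e5)).add (ss_nsm 4 e6)).add (ss_nsm 8 e7)).add (ss_nsm 16 e8)
  refine ss_congr tot ?_
  push_cast
  -- named sums
  have hV : (∑ i, ∑ a, (5 * y i * m a + y i * z i * N a i + 4 * y a ^ 2 * T a i) ^ 2)
      = 25 * (∑ i, ∑ a, y i ^ 2 * m a ^ 2) + 10 * (∑ i, ∑ a, y i ^ 2 * z i * m a * N a i)
        + (∑ i, ∑ a, y i ^ 2 * z i ^ 2 * N a i ^ 2)
        + 40 * (∑ i, ∑ a, y a ^ 2 * m a * (y i * T a i))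
        + 8 * (∑ i, ∑ a, y a ^ 2 * y i * z i * N a i * T a i)
        + 16 * (∑ i, ∑ a, (y a ^ 2) ^ 2 * T a i ^ 2) := by
    simp only [Finset.mul_sum, ← Finset.sum_add_distrib]
    refine Finset.sum_congr rfl fun i _ => Finset.sum_congr rfl fun a _ => ?_
    ring
  have hD : (∑ i, ∑ a, y a ^ 2 * m a * (y i * T a i)) = ∑ a, y a ^ 2 * m a ^ 2 := by
    rw [Finset.sum_comm]
    refine Finset.sum_congr rfl fun a _ => ?_
    rw [← Finset.mul_sum, hm]; ring
  have h25 : (∑ a, 25 * y a ^ 2 * m a ^ 2) = 25 * ∑ a, y a ^ 2 * m a ^ 2 := by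
    rw [Finset.mul_sum]; exact Finset.sum_congr rfl fun a _ => by ring
  have h1 : (∑ i, y i ^ 2 * (r * (Z - z i ^ 2) - ∑ a, (m a - z i * N a i) ^ 2))
      = r * (∑ i, y i ^ 2 * (Z - z i ^ 2)) - ((∑ i, ∑ a, y i ^ 2 * m a ^ 2)
        - 2 * (∑ i, ∑ a, y i ^ 2 * z i * m a * N a i)
        + ∑ i, ∑ a, y i ^ 2 * z i ^ 2 * N a i ^ 2) := by
    simp only [Finset.mul_sum, ← Finset.sum_add_distrib, ← Finset.sum_sub_distrib]
    refine Finset.sum_congr rfl fun i _ => ?_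
    rw [mul_sub, Finset.mul_sum]
    congr 1
    · ring
    · exact Finset.sum_congr rfl fun a _ => by ring
  have h2 : (∑ i, y i ^ 2 * z i ^ 2 * ((r - y i ^ 2) - ∑ a, N a i ^ 2))
      = (∑ i, y i ^ 2 * ((r - y i ^ 2) * z i ^ 2))
        - ∑ i, ∑ a, y i ^ 2 * z i ^ 2 * N a i ^ 2 := by
    rw [← Finset.sum_sub_distrib]
    refine Finset.sum_congr rfl fun i _ => ?_
    rw [← Finset.mul_sum]; ring
  have h3 : (∑ i, ∑ a ∈ Finset.univ.erase i, y i ^ 2 * (m a - 3 * (z i * N a i)) ^ 2)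
      = (∑ i, ∑ a, y i ^ 2 * m a ^ 2) - 6 * (∑ i, ∑ a, y i ^ 2 * z i * m a * N a i)
        + 9 * (∑ i, ∑ a, y i ^ 2 * z i ^ 2 * N a i ^ 2) - ∑ i, y i ^ 2 * m i ^ 2 := by
    simp only [Finset.mul_sum, ← Finset.sum_add_distrib, ← Finset.sum_sub_distrib]
    refine Finset.sum_congr rfl fun i _ => ?_
    rw [Finset.sum_erase_eq_sub (Finset.mem_univ i), hN i]
    congr 1
    · exact Finset.sum_congr rfl fun a _ => by ring
    · ring
  have h4 : (∑ i, ∑ a, (y a * z i * N a i - y a * y i * T a i) ^ 2)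
      = (∑ i, ∑ a, y a ^ 2 * (z i ^ 2 * N a i ^ 2))
        - 2 * (∑ i, ∑ a, y a ^ 2 * y i * z i * N a i * T a i)
        + ∑ i, ∑ a, y a ^ 2 * (y i ^ 2 * T a i ^ 2) := by
    simp only [Finset.mul_sum, ← Finset.sum_add_distrib, ← Finset.sum_sub_distrib]
    refine Finset.sum_congr rfl fun i _ => Finset.sum_congr rfl fun a _ => ?_
    ring
  have h5 : (∑ a, y a ^ 2 * ((Z - z a ^ 2) * (r - y a ^ 2) - ∑ i, z i ^ 2 * N a i ^ 2))
      = (∑ a, y a ^ 2 * ((r - y a ^ 2) * (Z - z a ^ 2)))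
        - ∑ i, ∑ a, y a ^ 2 * (z i ^ 2 * N a i ^ 2) := by
    rw [Finset.sum_comm (f := fun i a => y a ^ 2 * (z i ^ 2 * N a i ^ 2)),
      ← Finset.sum_sub_distrib]
    refine Finset.sum_congr rfl fun i _ => ?_
    rw [← Finset.mul_sum]; ring
  have h6 : (∑ a, y a ^ 2 * ((r - y a ^ 2) * (Z - z a ^ 2) - ∑ i, y i ^ 2 * T a i ^ 2))
      = (∑ a, y a ^ 2 * ((r - y a ^ 2) * (Z - z a ^ 2)))
        - ∑ i, ∑ a, y a ^ 2 * (y i ^ 2 * T a i ^ 2) := by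
    rw [Finset.sum_comm (f := fun i a => y a ^ 2 * (y i ^ 2 * T a i ^ 2)),
      ← Finset.sum_sub_distrib]
    refine Finset.sum_congr rfl fun i _ => ?_
    rw [← Finset.mul_sum]; ring
  have h8 : (∑ a, (y a ^ 2) ^ 2 * ((Z - z a ^ 2) - ∑ i, T a i ^ 2))
      = (∑ a, (y a ^ 2) ^ 2 * (Z - z a ^ 2)) - ∑ i, ∑ a, (y a ^ 2) ^ 2 * T a i ^ 2 := by
    rw [Finset.sum_comm (f := fun i a => (y a ^ 2) ^ 2 * T a i ^ 2),
      ← Finset.sum_sub_distrib]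
    refine Finset.sum_congr rfl fun i _ => ?_
    rw [← Finset.mul_sum]; ring
  have h9 : r * (∑ i, y i ^ 2 * (Z - z i ^ 2))
      = (∑ a, (y a ^ 2) ^ 2 * (Z - z a ^ 2))
        + ∑ a, y a ^ 2 * ((r - y a ^ 2) * (Z - z a ^ 2)) := by
    rw [Finset.mul_sum, ← Finset.sum_add_distrib]
    exact Finset.sum_congr rfl fun i _ => by ring
  rw [hV, hD, h25, h1, h2, h3, h4, h5, h6, h8]
  linear_combination 16 * h9

theorem half_lemma (x y z m : Fin n → R) (N T : Fin n → Fin n → R)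
    (hN : ∀ a, N a a = 0) (hT : ∀ a, T a a = 0)
    (hm : ∀ a, ∑ i, y i * T a i = m a)
    (b1 : ∀ i, IsSumSq ((∑ k, y k ^ 2) * ((∑ k, z k ^ 2) - z i ^ 2)
      - ∑ a, (m a - z i * N a i) ^ 2))
    (b2 : ∀ i, IsSumSq (((∑ k, y k ^ 2) - y i ^ 2) - ∑ a, N a i ^ 2))
    (b3 : ∀ a, IsSumSq (((∑ k, z k ^ 2) - z a ^ 2) - ∑ i, T a i ^ 2))
    (b4 : ∀ a, IsSumSq (((∑ k, y k ^ 2) - y a ^ 2) - ∑ i, N a i ^ 2)) :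
    IsSumSq (225 * (∑ i, y i ^ 2 * ((∑ k, x k ^ 2) - x i ^ 2))
      + 4 * (56 * (∑ k, y k ^ 2) * (∑ i, y i ^ 2 * ((∑ k, z k ^ 2) - z i ^ 2))
        + 96 * (∑ i, y i ^ 2 * (((∑ k, y k ^ 2) - y i ^ 2) * z i ^ 2)))
      - (300 * (∑ k, y k ^ 2) * (∑ a, x a * m a)
        + 60 * (∑ i, ∑ a, y i ^ 2 * (x a * z i * N a i))
        - 60 * (∑ a, y a ^ 2 * (x a * m a)))) := by
  have hc := core_lemma y z m N T hN hT hm b1 b2 b3 b4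
  have e : IsSumSq (∑ i, ∑ a ∈ Finset.univ.erase i, (15 * (y i * x a)
      - 2 * (5 * y i * m a + y i * z i * N a i + 4 * y a ^ 2 * T a i)) ^ 2) :=
    IsSumSq.sum fun i _ => IsSumSq.sum fun a _ => ss_sq _
  have tot := e.add (ss_nsm 4 hc)
  refine ss_congr tot ?_
  push_cast
  have h1 : (∑ i, ∑ a ∈ Finset.univ.erase i, (15 * (y i * x a)
      - 2 * (5 * y i * m a + y i * z i * N a i + 4 * y a ^ 2 * T a i)) ^ 2)
      = (225 * (∑ i, ∑ a, y i ^ 2 * x a ^ 2)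
        - (300 * (∑ i, ∑ a, y i ^ 2 * (x a * m a))
          + 60 * (∑ i, ∑ a, y i ^ 2 * (x a * z i * N a i))
          + 240 * (∑ i, ∑ a, x a * y a ^ 2 * (y i * T a i)))
        + 4 * (∑ i, ∑ a, (5 * y i * m a + y i * z i * N a i + 4 * y a ^ 2 * T a i) ^ 2))
        - (225 * (∑ i, y i ^ 2 * x i ^ 2) - 300 * (∑ i, y i ^ 2 * (x i * m i))
          + 4 * (∑ i, 25 * y i ^ 2 * m i ^ 2)) := by
    simp only [Finset.mul_sum, ← Finset.sum_add_distrib, ← Finset.sum_sub_distrib]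
    refine Finset.sum_congr rfl fun i _ => ?_
    rw [Finset.sum_erase_eq_sub (Finset.mem_univ i), hN i, hT i]
    congr 1
    · exact Finset.sum_congr rfl fun a _ => by ring
    · ring
  have h3 : (∑ i, y i ^ 2 * ((∑ k, x k ^ 2) - x i ^ 2))
      = (∑ i, ∑ a, y i ^ 2 * x a ^ 2) - ∑ i, y i ^ 2 * x i ^ 2 := by
    rw [← Finset.sum_sub_distrib]
    refine Finset.sum_congr rfl fun i _ => ?_
    rw [← Finset.mul_sum]; ring
  have h4 : (∑ i, ∑ a, y i ^ 2 * (x a * m a)) = (∑ k, y k ^ 2) * ∑ a, x a * m a := by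
    rw [Finset.sum_mul]
    exact Finset.sum_congr rfl fun i _ => by rw [← Finset.mul_sum]
  have h2 : (∑ i, ∑ a, x a * y a ^ 2 * (y i * T a i)) = ∑ a, y a ^ 2 * (x a * m a) := by
    rw [Finset.sum_comm]
    refine Finset.sum_congr rfl fun a _ => ?_
    rw [← Finset.mul_sum, hm]; ring
  rw [h1, h2, h3, h4]
  ring

theorem upd_sum (w v : Fin n → R) (i : Fin n) :
    ∑ k, w k * (Function.update v i 0) k = (∑ k, w k * v k) - w i * v i := by
  rw [← Finset.sum_erase_eq_sub (Finset.mem_univ i),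
    ← Finset.sum_erase (s := Finset.univ) (a := i) (by simp)]
  refine Finset.sum_congr rfl fun k hk => ?_
  rw [Function.update_of_ne (Finset.ne_of_mem_erase hk)]

theorem upd_sum_sq (v : Fin n → R) (i : Fin n) :
    ∑ k, (Function.update v i 0) k ^ 2 = (∑ k, v k ^ 2) - v i ^ 2 := by
  rw [← Finset.sum_erase_eq_sub (Finset.mem_univ i),
    ← Finset.sum_erase (s := Finset.univ) (a := i) (by simp)]
  refine Finset.sum_congr rfl fun k hk => ?_
  rw [Function.update_of_ne (Finset.ne_of_mem_erase hk)]

theorem single_sum (w : Fin n → R) (i : Fin n) :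
    ∑ k, w k * (Pi.single i (1 : R) : Fin n → R) k = w i := by
  simp [Pi.single_apply]

theorem single_sum_sq (i : Fin n) :
    ∑ k, (Pi.single i (1 : R) : Fin n → R) k ^ 2 = 1 := by
  simp [Pi.single_apply]

theorem half_tensor (t : Fin n → Fin n → Fin n → R) (x y z : Fin n → R)
    (h0 : ∀ a b c : Fin n, (a = b ∨ a = c ∨ b = c) → t a b c = 0)
    (hA : ∀ η ζ : Fin n → R, IsSumSq ((∑ k, η k ^ 2) * (∑ k, ζ k ^ 2)
      - ∑ a, (∑ b, ∑ c, t a b c * η b * ζ c) ^ 2))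
    (hB : ∀ ξ ζ : Fin n → R, IsSumSq ((∑ k, ξ k ^ 2) * (∑ k, ζ k ^ 2)
      - ∑ b, (∑ a, ∑ c, t a b c * ξ a * ζ c) ^ 2))
    (hC : ∀ ξ η : Fin n → R, IsSumSq ((∑ k, ξ k ^ 2) * (∑ k, η k ^ 2)
      - ∑ c, (∑ a, ∑ b, t a b c * ξ a * η b) ^ 2)) :
    IsSumSq (225 * (∑ i, y i ^ 2 * ((∑ k, x k ^ 2) - x i ^ 2))
      + 4 * (56 * (∑ k, y k ^ 2) * (∑ i, y i ^ 2 * ((∑ k, z k ^ 2) - z i ^ 2))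
        + 96 * (∑ i, y i ^ 2 * (((∑ k, y k ^ 2) - y i ^ 2) * z i ^ 2)))
      - (300 * (∑ k, y k ^ 2) * (∑ a, x a * (∑ b, ∑ c, t a b c * y b * z c))
        + 60 * (∑ i, ∑ a, y i ^ 2 * (x a * z i * (∑ b, t a b i * y b)))
        - 60 * (∑ a, y a ^ 2 * (x a * (∑ b, ∑ c, t a b c * y b * z c))))) := by
  refine half_lemma x y z (fun a => ∑ b, ∑ c, t a b c * y b * z c)
    (fun a i => ∑ b, t a b i * y b) (fun a i => ∑ c, t a i c * z c) ?_ ?_ ?_ ?_ ?_ ?_ ?_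
  · intro a
    exact Finset.sum_eq_zero fun b _ => by rw [h0 a b a (by simp), zero_mul]
  · intro a
    exact Finset.sum_eq_zero fun b _ => by rw [h0 a a b (by simp), zero_mul]
  · intro a
    refine Finset.sum_congr rfl fun i _ => ?_
    rw [Finset.mul_sum]
    exact Finset.sum_congr rfl fun c _ => by ring
  · intro i
    refine ss_congr (hA y (Function.update z i 0)) ?_
    rw [upd_sum_sq]
    congr 1
    refine Finset.sum_congr rfl fun a _ => ?_
    congr 1
    simp only [upd_sum, Finset.sum_sub_distrib, ← Finset.sum_mul]
    ring
  · intro i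
    refine ss_congr (hA (Function.update y i 0) (Pi.single i 1)) ?_
    rw [upd_sum_sq, single_sum_sq, mul_one]
    congr 1
    refine Finset.sum_congr rfl fun a _ => ?_
    congr 1
    simp only [single_sum, upd_sum]
    rw [h0 a i i (by simp)]; ring
  · intro a
    refine ss_congr (hB (Pi.single a 1) (Function.update z a 0)) ?_
    rw [upd_sum_sq, single_sum_sq, one_mul]
    congr 1
    refine Finset.sum_congr rfl fun b _ => ?_
    congr 1
    rw [Finset.sum_comm]
    simp only [← Finset.sum_mul, single_sum, upd_sum]
    rw [h0 a b a (by simp)]; ring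
  · intro a
    refine ss_congr (hC (Pi.single a 1) (Function.update y a 0)) ?_
    rw [upd_sum_sq, single_sum_sq, one_mul]
    congr 1
    refine Finset.sum_congr rfl fun b _ => ?_
    congr 1
    rw [Finset.sum_comm]
    simp only [← Finset.sum_mul, single_sum, upd_sum]
    rw [h0 a a b (by simp)]; ring

theorem both_tensor (t : Fin n → Fin n → Fin n → R) (x y z : Fin n → R)
    (h0 : ∀ a b c : Fin n, (a = b ∨ a = c ∨ b = c) → t a b c = 0)
    (hA : ∀ η ζ : Fin n → R, IsSumSq ((∑ k, η k ^ 2) * (∑ k, ζ k ^ 2)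
      - ∑ a, (∑ b, ∑ c, t a b c * η b * ζ c) ^ 2))
    (hB : ∀ ξ ζ : Fin n → R, IsSumSq ((∑ k, ξ k ^ 2) * (∑ k, ζ k ^ 2)
      - ∑ b, (∑ a, ∑ c, t a b c * ξ a * ζ c) ^ 2))
    (hC : ∀ ξ η : Fin n → R, IsSumSq ((∑ k, ξ k ^ 2) * (∑ k, η k ^ 2)
      - ∑ c, (∑ a, ∑ b, t a b c * ξ a * η b) ^ 2)) :
    IsSumSq ((225 + 224 * (∑ k, y k ^ 2)) * ((∑ i, y i ^ 2 * ((∑ k, x k ^ 2) - x i ^ 2))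
        + (∑ i, y i ^ 2 * ((∑ k, z k ^ 2) - z i ^ 2)))
      + 384 * ((∑ i, y i ^ 2 * (((∑ k, y k ^ 2) - y i ^ 2) * x i ^ 2))
        + (∑ i, y i ^ 2 * (((∑ k, y k ^ 2) - y i ^ 2) * z i ^ 2)))
      - 600 * (∑ k, y k ^ 2) * (∑ a, ∑ b, ∑ c, t a b c * x a * y b * z c)) := by
  have H1 := half_tensor t x y z h0 hA hB hC
  have H2 := half_tensor (fun a b c => t c b a) z y x
    (fun a b c h => h0 c b a (by
      rcases h with h | h | h
      · exact Or.inr (Or.inr h.symm)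
      · exact Or.inr (Or.inl h.symm)
      · exact Or.inl h.symm))
    (fun η ζ => ss_congr (hC ζ η) (by
      rw [mul_comm]
      congr 1
      refine Finset.sum_congr rfl fun a _ => ?_
      congr 1
      rw [Finset.sum_comm]
      exact Finset.sum_congr rfl fun c _ => Finset.sum_congr rfl fun b _ => by ring))
    (fun ξ ζ => ss_congr (hB ζ ξ) (by
      rw [mul_comm]
      congr 1
      refine Finset.sum_congr rfl fun a _ => ?_
      congr 1
      rw [Finset.sum_comm]
      exact Finset.sum_congr rfl fun c _ => Finset.sum_congr rfl fun b _ => by ring))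
    (fun ξ η => ss_congr (hA η ξ) (by
      rw [mul_comm]
      congr 1
      refine Finset.sum_congr rfl fun a _ => ?_
      congr 1
      rw [Finset.sum_comm]
      exact Finset.sum_congr rfl fun c _ => Finset.sum_congr rfl fun b _ => by ring))
  refine ss_congr (H1.add H2) ?_
  have k1 : (∑ a, x a * (∑ b, ∑ c, t a b c * y b * z c))
      = ∑ a, ∑ b, ∑ c, t a b c * x a * y b * z c := by
    simp only [Finset.mul_sum]
    refine Finset.sum_congr rfl fun a _ => Finset.sum_congr rfl fun b _ =>
      Finset.sum_congr rfl fun c _ => by ring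
  have k2 : (∑ c, z c * (∑ b, ∑ a, t a b c * y b * x a))
      = ∑ a, ∑ b, ∑ c, t a b c * x a * y b * z c := by
    rw [Finset.sum_congr rfl fun c _ => by
      rw [Finset.sum_comm (f := fun b a => t a b c * y b * x a)]]
    simp only [Finset.mul_sum]
    rw [Finset.sum_comm]
    refine Finset.sum_congr rfl fun a _ => ?_
    rw [Finset.sum_comm]
    exact Finset.sum_congr rfl fun b _ => Finset.sum_congr rfl fun c _ => by ring
  have k3 : (∑ i, ∑ c, y i ^ 2 * (z c * x i * (∑ b, t i b c * y b)))
      = ∑ a, y a ^ 2 * (x a * (∑ b, ∑ c, t a b c * y b * z c)) := by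
    refine Finset.sum_congr rfl fun i _ => ?_
    rw [Finset.sum_comm (f := fun b c => t i b c * y b * z c)]
    simp only [Finset.mul_sum]
    exact Finset.sum_congr rfl fun a _ => Finset.sum_congr rfl fun b _ => by ring
  have k4 : (∑ c, y c ^ 2 * (z c * (∑ b, ∑ a, t a b c * y b * x a)))
      = ∑ i, ∑ a, y i ^ 2 * (x a * z i * (∑ b, t a b i * y b)) := by
    refine Finset.sum_congr rfl fun i _ => ?_
    rw [Finset.sum_comm (f := fun b a => t a b i * y b * x a)]
    simp only [Finset.mul_sum]
    exact Finset.sum_congr rfl fun a _ => Finset.sum_congr rfl fun b _ => by ring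
  rw [k1, k2, k3, k4]
  ring

theorem pair_ss (y : Fin n → R) (j : Fin n) :
    IsSumSq ((∑ i, y i ^ 2 * ((∑ k, y k ^ 2) - y i ^ 2))
      - 2 * (y j ^ 2 * ((∑ k, y k ^ 2) - y j ^ 2))) := by
  have h : IsSumSq (∑ i ∈ Finset.univ.erase j,
      y i ^ 2 * ((∑ k, y k ^ 2) - y j ^ 2 - y i ^ 2)) :=
    IsSumSq.sum fun i hi => (ss_sq _).mul (ss_sub2 y (Finset.ne_of_mem_erase hi))
  refine ss_congr h ?_
  rw [Finset.sum_erase_eq_sub (Finset.mem_univ j)]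
  have e : (∑ i, y i ^ 2 * ((∑ k, y k ^ 2) - y j ^ 2 - y i ^ 2))
      = (∑ i, y i ^ 2 * ((∑ k, y k ^ 2) - y i ^ 2)) - (∑ i, y i ^ 2) * y j ^ 2 := by
    rw [Finset.sum_mul, ← Finset.sum_sub_distrib]
    exact Finset.sum_congr rfl fun i _ => by ring
  rw [e]; ring

theorem diag_ss (x y : Fin n → R) :
    IsSumSq (225 * ((∑ i, y i ^ 2 * ((∑ k, y k ^ 2) - y i ^ 2)) * (∑ k, x k ^ 2))
      - 384 * (∑ i, y i ^ 2 * (((∑ k, y k ^ 2) - y i ^ 2) * x i ^ 2))) := by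
  have h1 : IsSumSq (∑ j, x j ^ 2 * ((∑ i, y i ^ 2 * ((∑ k, y k ^ 2) - y i ^ 2))
      - 2 * (y j ^ 2 * ((∑ k, y k ^ 2) - y j ^ 2)))) :=
    IsSumSq.sum fun j _ => (ss_sq _).mul (pair_ss y j)
  have h2 : IsSumSq ((∑ i, y i ^ 2 * ((∑ k, y k ^ 2) - y i ^ 2)) * (∑ k, x k ^ 2)) :=
    (IsSumSq.sum fun i _ => (ss_sq _).mul (ss_sub1 y i)).mul (IsSumSq.sum fun i _ => ss_sq _)
  refine ss_congr ((ss_nsm 192 h1).add (ss_nsm 33 h2)) ?_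
  push_cast
  have e : (∑ j, x j ^ 2 * ((∑ i, y i ^ 2 * ((∑ k, y k ^ 2) - y i ^ 2))
      - 2 * (y j ^ 2 * ((∑ k, y k ^ 2) - y j ^ 2))))
      = (∑ k, x k ^ 2) * (∑ i, y i ^ 2 * ((∑ k, y k ^ 2) - y i ^ 2))
        - 2 * (∑ i, y i ^ 2 * (((∑ k, y k ^ 2) - y i ^ 2) * x i ^ 2)) := by
    rw [Finset.sum_mul, Finset.mul_sum (s := Finset.univ) (a := (2 : R)),
      ← Finset.sum_sub_distrib]
    exact Finset.sum_congr rfl fun i _ => by ring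
  rw [e]; ring

theorem final_tensor (t : Fin n → Fin n → Fin n → R) (x y z : Fin n → R)
    (h0 : ∀ a b c : Fin n, (a = b ∨ a = c ∨ b = c) → t a b c = 0)
    (hA : ∀ η ζ : Fin n → R, IsSumSq ((∑ k, η k ^ 2) * (∑ k, ζ k ^ 2)
      - ∑ a, (∑ b, ∑ c, t a b c * η b * ζ c) ^ 2))
    (hB : ∀ ξ ζ : Fin n → R, IsSumSq ((∑ k, ξ k ^ 2) * (∑ k, ζ k ^ 2)
      - ∑ b, (∑ a, ∑ c, t a b c * ξ a * ζ c) ^ 2))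
    (hC : ∀ ξ η : Fin n → R, IsSumSq ((∑ k, ξ k ^ 2) * (∑ k, η k ^ 2)
      - ∑ c, (∑ a, ∑ b, t a b c * ξ a * η b) ^ 2)) :
    IsSumSq (450 * ((∑ i, y i ^ 2 * ((∑ k, x k ^ 2) - x i ^ 2))
        + (∑ i, y i ^ 2 * ((∑ k, z k ^ 2) - z i ^ 2)))
      + 225 * ((∑ i, y i ^ 2 * ((∑ k, y k ^ 2) - y i ^ 2))
        * ((∑ k, x k ^ 2) + (∑ k, z k ^ 2)))
      - 600 * (∑ a, ∑ b, ∑ c, t a b c * x a * y b * z c)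
      + (600 * (∑ a, ∑ b, ∑ c, t a b c * x a * y b * z c)
        - 224 * ((∑ i, y i ^ 2 * ((∑ k, x k ^ 2) - x i ^ 2))
        + (∑ i, y i ^ 2 * ((∑ k, z k ^ 2) - z i ^ 2)))) * (1 - ∑ k, y k ^ 2)) := by
  have n1 : ∀ v : Fin n → R, IsSumSq (∑ i, y i ^ 2 * ((∑ k, v k ^ 2) - v i ^ 2)) :=
    fun v => IsSumSq.sum fun i _ => (ss_sq _).mul (ss_sub1 v i)
  refine ss_congr ((((both_tensor t x y z h0 hA hB hC).add ((n1 x).add (n1 z))).add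
    (diag_ss x y)).add (diag_ss z y)) ?_
  ring

/-- Optimizing the first vector in a trilinear inequality. -/
theorem opt_ss (S : R) (v : Fin n → R)
    (h : ∀ ξ : Fin n → R, IsSumSq ((∑ k, ξ k ^ 2) + S - 2 * ∑ a, ξ a * v a)) :
    IsSumSq (S - ∑ a, v a ^ 2) := by
  refine ss_congr (h v) ?_
  simp only [← pow_two]
  ring

end Aux

section Spec
variable {n : ℕ}

theorem C_pos_ss {σ : Type*} {e : ℝ} (he : 0 ≤ e) :
    IsSumSq (C e : MvPolynomial σ ℝ) :=
  ss_congr (ss_sq (C (Real.sqrt e) : MvPolynomial σ ℝ)) (by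
    rw [← C_pow, Real.sq_sqrt he])

theorem subst_form (T' : Fin n → Fin n → Fin n → ℝ)
    (ξ η ζ : Fin n → MvPolynomial (Fin n ⊕ Fin n ⊕ Fin n) ℝ) :
    aeval (Sum.elim ξ (Sum.elim η ζ)) (formPoly T')
      = ∑ a, ∑ b, ∑ c, C (T' a b c) * ξ a * η b * ζ c := by
  simp [formPoly, XVar, YVar, ZVar, map_sum, MvPolynomial.algebraMap_eq]

theorem form_scale {ε : ℝ} (hε : 0 < ε) (T' : Fin n → Fin n → Fin n → ℝ)
    (ξ η ζ : Fin n → MvPolynomial (Fin n ⊕ Fin n ⊕ Fin n) ℝ) :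
    C (1 / ε) * (∑ a, ∑ b, ∑ c, C (T' a b c) * ξ a * η b * ζ c)
      = 2 * ∑ a, ∑ b, ∑ c, C (T' a b c / (2 * ε)) * ξ a * η b * ζ c := by
  simp only [Finset.mul_sum]
  refine Finset.sum_congr rfl fun a _ => Finset.sum_congr rfl fun b _ =>
    Finset.sum_congr rfl fun c _ => ?_
  have h2 : (2 : MvPolynomial (Fin n ⊕ Fin n ⊕ Fin n) ℝ) = C 2 := (map_ofNat C 2).symm
  have : C (1 / ε) * C (T' a b c)
      = (2 : MvPolynomial (Fin n ⊕ Fin n ⊕ Fin n) ℝ) * C (T' a b c / (2 * ε)) := by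
    rw [h2, ← C_mul, ← C_mul]
    congr 1
    field_simp
  linear_combination (ξ a * η b * ζ c) * this

theorem C_inv_mul {ε : ℝ} (hε : 0 < ε) :
    (C (1 / ε) * C ε : MvPolynomial (Fin n ⊕ Fin n ⊕ Fin n) ℝ) = 1 := by
  rw [← C_mul, one_div, inv_mul_cancel₀ hε.ne', C_1]

theorem deg_N1 (v : Fin n → MvPolynomial (Fin n ⊕ Fin n ⊕ Fin n) ℝ)
    (hv : ∀ i, (v i).totalDegree ≤ 1) :
    (∑ i, YVar i ^ 2 * ((∑ k, v k ^ 2) - v i ^ 2)).totalDegree ≤ 4 := by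
  have h2 : ∀ i, (v i ^ 2).totalDegree ≤ 2 := fun i =>
    (totalDegree_pow _ _).trans (by have := hv i; omega)
  refine totalDegree_finsetSum_le fun i _ => (totalDegree_mul _ _).trans ?_
  have a1 : (YVar i ^ 2 : MvPolynomial (Fin n ⊕ Fin n ⊕ Fin n) ℝ).totalDegree ≤ 2 :=
    (totalDegree_pow _ _).trans (by simp [YVar, totalDegree_X])
  have a2 : ((∑ k, v k ^ 2) - v i ^ 2).totalDegree ≤ 2 :=
    (totalDegree_sub _ _).trans (max_le (totalDegree_finsetSum_le fun k _ => h2 k) (h2 i))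
  omega

theorem deg_form (T' : Fin n → Fin n → Fin n → ℝ) : (formPoly T').totalDegree ≤ 4 := by
  refine totalDegree_finsetSum_le fun a _ => totalDegree_finsetSum_le fun b _ =>
    totalDegree_finsetSum_le fun c _ => ?_
  have h1 := totalDegree_mul (C (T' a b c) * XVar a * YVar b) (ZVar c)
  have h2 := totalDegree_mul (C (T' a b c) * XVar a) (YVar b)
  have h3 := totalDegree_mul (C (T' a b c)) (XVar a)
  simp only [XVar, YVar, ZVar, totalDegree_X, totalDegree_C] at h1 h2 h3 ⊢
  omega

end Spec

theorem stmt_6 (n : ℕ) (ε : ℝ) (hε : 0 < ε)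
    (T' : Fin n → Fin n → Fin n → ℝ)
    (hmult : ∀ a b c : Fin n, (a = b ∨ a = c ∨ b = c) → T' a b c = 0)
    (hs1 : IsSumSq
      (C ε * ((∑ i, XVar i ^ 2) + (∑ i, YVar i ^ 2) * (∑ i, ZVar i ^ 2)) - formPoly T'))
    (hs2 : IsSumSq
      (C ε * ((∑ i, YVar i ^ 2) + (∑ i, XVar i ^ 2) * (∑ i, ZVar i ^ 2)) - formPoly T'))
    (hs3 : IsSumSq
      (C ε * ((∑ i, ZVar i ^ 2) + (∑ i, XVar i ^ 2) * (∑ i, YVar i ^ 2)) - formPoly T')) :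
    ∃ q : MvPolynomial (Fin n ⊕ Fin n ⊕ Fin n) ℝ, q.totalDegree ≤ 4 ∧
      IsSumSq
        (C (3 * ε / 2) * (∑ i : Fin n, ∑ j ∈ Finset.univ.erase i,
            YVar i ^ 2 *
              (XVar j ^ 2 + ZVar j ^ 2 +
                C (1/2 : ℝ) * YVar j ^ 2 * ((∑ k, XVar k ^ 2) + (∑ k, ZVar k ^ 2))))
          - formPoly T'
          + q * (1 - ∑ i, YVar i ^ 2)) := by
  set x : Fin n → MvPolynomial (Fin n ⊕ Fin n ⊕ Fin n) ℝ := fun i => XVar i with hx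
  set y : Fin n → MvPolynomial (Fin n ⊕ Fin n ⊕ Fin n) ℝ := fun i => YVar i with hy
  set z : Fin n → MvPolynomial (Fin n ⊕ Fin n ⊕ Fin n) ℝ := fun i => ZVar i with hz
  set t : Fin n → Fin n → Fin n → MvPolynomial (Fin n ⊕ Fin n ⊕ Fin n) ℝ :=
    fun a b c => C (T' a b c / (2 * ε)) with ht
  have hc : IsSumSq (C (1 / ε) : MvPolynomial (Fin n ⊕ Fin n ⊕ Fin n) ℝ) :=
    C_pos_ss (by positivity)
  have g1 : ∀ ξ η ζ : Fin n → MvPolynomial (Fin n ⊕ Fin n ⊕ Fin n) ℝ,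
      IsSumSq ((∑ k, ξ k ^ 2) + (∑ k, η k ^ 2) * (∑ k, ζ k ^ 2)
        - 2 * ∑ a, ∑ b, ∑ c, t a b c * ξ a * η b * ζ c) := by
    intro ξ η ζ
    have h := ss_map (aeval (R := ℝ) (Sum.elim ξ (Sum.elim η ζ))).toRingHom hs1
    refine ss_congr (hc.mul h) ?_
    rw [← form_scale hε, ← subst_form]
    simp only [AlgHom.toRingHom_eq_coe, RingHom.coe_coe, map_sub, map_mul, map_add, map_sum,
      map_pow, aeval_X, Sum.elim_inl, Sum.elim_inr, algHom_C, MvPolynomial.algebraMap_eq]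
    linear_combination (-((∑ k, ξ k ^ 2) + (∑ k, η k ^ 2) * (∑ k, ζ k ^ 2))) * C_inv_mul hε
  have g2 : ∀ ξ η ζ : Fin n → MvPolynomial (Fin n ⊕ Fin n ⊕ Fin n) ℝ,
      IsSumSq ((∑ k, η k ^ 2) + (∑ k, ξ k ^ 2) * (∑ k, ζ k ^ 2)
        - 2 * ∑ a, ∑ b, ∑ c, t a b c * ξ a * η b * ζ c) := by
    intro ξ η ζ
    have h := ss_map (aeval (R := ℝ) (Sum.elim ξ (Sum.elim η ζ))).toRingHom hs2
    refine ss_congr (hc.mul h) ?_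
    rw [← form_scale hε, ← subst_form]
    simp only [AlgHom.toRingHom_eq_coe, RingHom.coe_coe, map_sub, map_mul, map_add, map_sum,
      map_pow, aeval_X, Sum.elim_inl, Sum.elim_inr, algHom_C, MvPolynomial.algebraMap_eq]
    linear_combination (-((∑ k, η k ^ 2) + (∑ k, ξ k ^ 2) * (∑ k, ζ k ^ 2))) * C_inv_mul hε
  have g3 : ∀ ξ η ζ : Fin n → MvPolynomial (Fin n ⊕ Fin n ⊕ Fin n) ℝ,
      IsSumSq ((∑ k, ζ k ^ 2) + (∑ k, ξ k ^ 2) * (∑ k, η k ^ 2)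
        - 2 * ∑ a, ∑ b, ∑ c, t a b c * ξ a * η b * ζ c) := by
    intro ξ η ζ
    have h := ss_map (aeval (R := ℝ) (Sum.elim ξ (Sum.elim η ζ))).toRingHom hs3
    refine ss_congr (hc.mul h) ?_
    rw [← form_scale hε, ← subst_form]
    simp only [AlgHom.toRingHom_eq_coe, RingHom.coe_coe, map_sub, map_mul, map_add, map_sum,
      map_pow, aeval_X, Sum.elim_inl, Sum.elim_inr, algHom_C, MvPolynomial.algebraMap_eq]
    linear_combination (-((∑ k, ζ k ^ 2) + (∑ k, ξ k ^ 2) * (∑ k, η k ^ 2))) * C_inv_mul hε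
  have h0 : ∀ a b c : Fin n, (a = b ∨ a = c ∨ b = c) → t a b c = 0 := by
    intro a b c h
    simp [ht, hmult a b c h]
  have main := final_tensor t x y z h0
    (fun η ζ => opt_ss _ _ fun ξ => ss_congr (g1 ξ η ζ) (by
      congr 2
      refine Finset.sum_congr rfl fun a _ => ?_
      simp only [Finset.mul_sum]
      exact Finset.sum_congr rfl fun b _ => Finset.sum_congr rfl fun c _ => by ring))
    (fun ξ ζ => opt_ss _ _ fun η => ss_congr (g2 ξ η ζ) (by
      congr 2
      rw [Finset.sum_comm (f := fun a b => ∑ c, t a b c * ξ a * η b * ζ c)]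
      refine Finset.sum_congr rfl fun b _ => ?_
      simp only [Finset.mul_sum]
      exact Finset.sum_congr rfl fun a _ => Finset.sum_congr rfl fun c _ => by ring))
    (fun ξ η => opt_ss _ _ fun ζ => ss_congr (g3 ξ η ζ) (by
      congr 2
      simp only [Finset.mul_sum]
      rw [Finset.sum_comm]
      refine Finset.sum_congr rfl fun a _ => ?_
      rw [Finset.sum_comm]
      exact Finset.sum_congr rfl fun b _ => Finset.sum_congr rfl fun c _ => by ring))
  have hF : formPoly T' = C (2 * ε) * ∑ a, ∑ b, ∑ c, t a b c * x a * y b * z c := by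
    unfold formPoly
    simp only [Finset.mul_sum]
    refine Finset.sum_congr rfl fun a _ => Finset.sum_congr rfl fun b _ =>
      Finset.sum_congr rfl fun c _ => ?_
    have : (C (T' a b c) : MvPolynomial (Fin n ⊕ Fin n ⊕ Fin n) ℝ)
        = C (2 * ε) * C (T' a b c / (2 * ε)) := by
      rw [← C_mul]; congr 1; field_simp
    rw [this]; ring
  refine ⟨formPoly T' - C (224 * ε / 300) * ((∑ i, y i ^ 2 * ((∑ k, x k ^ 2) - x i ^ 2))
        + (∑ i, y i ^ 2 * ((∑ k, z k ^ 2) - z i ^ 2))), ?_, ?_⟩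
  · refine (totalDegree_sub _ _).trans (max_le (deg_form T') ?_)
    refine (totalDegree_mul _ _).trans ?_
    rw [totalDegree_C, zero_add]
    exact (totalDegree_add _ _).trans (max_le
      (deg_N1 x fun i => by simp [hx, XVar, totalDegree_X])
      (deg_N1 z fun i => by simp [hz, ZVar, totalDegree_X]))
  · have hk : IsSumSq (C (ε / 300) : MvPolynomial (Fin n ⊕ Fin n ⊕ Fin n) ℝ) :=
      C_pos_ss (by positivity)
    refine ss_congr (hk.mul main) ?_
    have hR : (∑ i : Fin n, ∑ j ∈ Finset.univ.erase i,
            YVar i ^ 2 *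
              (XVar j ^ 2 + ZVar j ^ 2 +
                C (1/2 : ℝ) * YVar j ^ 2 * ((∑ k, XVar k ^ 2) + (∑ k, ZVar k ^ 2))))
        = (∑ i, y i ^ 2 * ((∑ k, x k ^ 2) - x i ^ 2))
          + (∑ i, y i ^ 2 * ((∑ k, z k ^ 2) - z i ^ 2))
          + C (1/2 : ℝ) * ((∑ i, y i ^ 2 * ((∑ k, y k ^ 2) - y i ^ 2))
            * ((∑ k, x k ^ 2) + (∑ k, z k ^ 2))) := by
      have e1 : C (1/2 : ℝ) * ((∑ i, y i ^ 2 * ((∑ k, y k ^ 2) - y i ^ 2))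
            * ((∑ k, x k ^ 2) + (∑ k, z k ^ 2)))
          = ∑ i, C (1/2 : ℝ) * (y i ^ 2 * ((∑ k, y k ^ 2) - y i ^ 2)
            * ((∑ k, x k ^ 2) + (∑ k, z k ^ 2))) := by
        rw [← Finset.mul_sum, ← Finset.sum_mul]
      rw [e1]
      refine Eq.trans (b := ∑ i, (y i ^ 2 * ((∑ k, x k ^ 2) - x i ^ 2)
          + y i ^ 2 * ((∑ k, z k ^ 2) - z i ^ 2)
          + C (1/2 : ℝ) * (y i ^ 2 * ((∑ k, y k ^ 2) - y i ^ 2)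
            * ((∑ k, x k ^ 2) + (∑ k, z k ^ 2))))) ?_
        (by rw [Finset.sum_add_distrib, Finset.sum_add_distrib])
      refine Finset.sum_congr rfl fun i _ => ?_
      rw [Finset.sum_erase_eq_sub (Finset.mem_univ i), ← Finset.mul_sum,
        Finset.sum_add_distrib, Finset.sum_add_distrib, ← Finset.sum_mul, ← Finset.mul_sum]
      simp only [hx, hy, hz]
      ring
    rw [hR, hF]
    have c1 : (C (3 * ε / 2) : MvPolynomial (Fin n ⊕ Fin n ⊕ Fin n) ℝ) = 450 * C (ε / 300) := by
      have : (450 : MvPolynomial (Fin n ⊕ Fin n ⊕ Fin n) ℝ) = C 450 := (map_ofNat C 450).symm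
      rw [this, ← C_mul]; congr 1; ring
    have c2 : (C (2 * ε) : MvPolynomial (Fin n ⊕ Fin n ⊕ Fin n) ℝ) = 600 * C (ε / 300) := by
      have : (600 : MvPolynomial (Fin n ⊕ Fin n ⊕ Fin n) ℝ) = C 600 := (map_ofNat C 600).symm
      rw [this, ← C_mul]; congr 1; ring
    have c3 : (C (224 * ε / 300) : MvPolynomial (Fin n ⊕ Fin n ⊕ Fin n) ℝ)
        = 224 * C (ε / 300) := by
      have : (224 : MvPolynomial (Fin n ⊕ Fin n ⊕ Fin n) ℝ) = C 224 := (map_ofNat C 224).symm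
      rw [this, ← C_mul]; congr 1; ring
    have c4 : (450 * C (1 / 2) : MvPolynomial (Fin n ⊕ Fin n ⊕ Fin n) ℝ) = 225 := by
      have h1 : (450 : MvPolynomial (Fin n ⊕ Fin n ⊕ Fin n) ℝ) = C 450 := (map_ofNat C 450).symm
      have h2 : (225 : MvPolynomial (Fin n ⊕ Fin n ⊕ Fin n) ℝ) = C 225 := (map_ofNat C 225).symm
      rw [h1, h2, ← C_mul]; congr 1; norm_num
    rw [c1, c2, c3]
    linear_combination (C (ε / 300) * ((∑ i, y i ^ 2 * ((∑ k, y k ^ 2) - y i ^ 2))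
            * ((∑ k, x k ^ 2) + (∑ k, z k ^ 2)))) * c4

end
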